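/- arXiv:2604.24513 — 6 statements merged into one kernel-verified Lean document; each statement's English description precedes it below -/
import Mathlib

section
/- Let (𝔥, 𝔤, t, α) be a crossed module of real Lie algebras, let u : 𝔤 → 𝔥 be an ℝ-linear map, and let κ : 𝔤 × 𝔤 → 𝔥 be an ℝ-bilinear map satisfying, for all X, X₁, X₂, X₃ ∈ 𝔤 and Y ∈ 𝔥: (i) κ(X, t(Y)) = α(X)(Y); (ii) κ(t(Y), X) = −α(X)(Y); (iii) κ(⁅X₁, X₂⁆, X₃) = κ(X₁, ⁅X₂, X₃⁆) + κ(X₂, ⁅X₃, X₁⁆); (iv) t(κ(X₁, X₂)) = t(u(⁅X₁, X₂⁆)). Let 𝔞 := ker t, let 𝔣 := 𝔤 ⧸ range(t) be the quotient Lie algebra (range t is an ideal), and let p : 𝔤 → 𝔣 be the projection. Then there exists a unique bilinear map b : 𝔣 × 𝔣 → 𝔞 such that b(p(X₁), p(X₂)) = (1/2)·(κ(X₁, X₂) + κ(X₂, X₁)) for all X₁, X₂ ∈ 𝔤; moreover b is symmetric and invariant, i.e. b(⁅Z₁, Z₂⁆, Z₃) = b(Z₁, ⁅Z₂, Z₃⁆)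 for all Z₁, Z₂, Z₃ ∈ 𝔣. -/
/-- A bilinear map that vanishes as soon as one argument lies in `I` descends to the quotient
by `I`. -/
theorem LinearMap.exists_quotient_bilinear {R M N : Type*} [CommRing R] [AddCommGroup M]
    [Module R M] [AddCommGroup N] [Module R N] (I : Submodule R M) (s : M →ₗ[R] M →ₗ[R] N)
    (h_left : ∀ x ∈ I, ∀ y, s x y = 0) (h_right : ∀ x, ∀ y ∈ I, s x y = 0) :
    ∃ b : (M ⧸ I) →ₗ[R] (M ⧸ I) →ₗ[R] N,
      ∀ x y, b (Submodule.Quotient.mk x) (Submodule.Quotient.mk y) = s x y := by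
  let r : (M ⧸ I) →ₗ[R] M →ₗ[R] N :=
    I.liftQ s fun x hx => LinearMap.mem_ker.2 (LinearMap.ext (h_left x hx))
  refine ⟨(I.liftQ r.flip fun y hy => LinearMap.mem_ker.2 (LinearMap.ext fun z => ?_)).flip,
    fun x y => rfl⟩
  obtain ⟨x, rfl⟩ := Submodule.Quotient.mk_surjective I z
  exact h_right x y hy


/-- Given a crossed module of real Lie algebras `(𝔥, 𝔤, t, α)`, a linear map `u : 𝔤 → 𝔥`
and a bilinear map `κ : 𝔤 × 𝔤 → 𝔥` satisfying the identities of the bilinear form of an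
adapted adjustment, there is a unique bilinear map `b : 𝔣 × 𝔣 → 𝔞` (with `𝔞 = ker t` and
`𝔣 = 𝔤 ⧸ range t`) with `b (p X₁) (p X₂) = (1/2)(κ X₁ X₂ + κ X₂ X₁)`; moreover `b` is
symmetric and invariant. -/
theorem adjustment_symmetric_invariant_bilinear_form
    {𝔥 𝔤 : Type*}
    [LieRing 𝔥] [LieAlgebra ℝ 𝔥] [LieRing 𝔤] [LieAlgebra ℝ 𝔤]
    (t : 𝔥 →ₗ⁅ℝ⁆ 𝔤) (α : 𝔤 →ₗ⁅ℝ⁆ LieDerivation ℝ 𝔥 𝔥)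
    (h_peiffer : ∀ Y Y' : 𝔥, α (t Y) Y' = ⁅Y, Y'⁆)
    (h_equiv : ∀ (X : 𝔤) (Y : 𝔥), t (α X Y) = ⁅X, t Y⁆)
    (u : 𝔤 →ₗ[ℝ] 𝔥) (κ : 𝔤 →ₗ[ℝ] 𝔤 →ₗ[ℝ] 𝔥)
    (hκ1 : ∀ (X : 𝔤) (Y : 𝔥), κ X (t Y) = α X Y)
    (hκ2 : ∀ (X : 𝔤) (Y : 𝔥), κ (t Y) X = -(α X Y))
    (hκ3 : ∀ X₁ X₂ X₃ : 𝔤, κ ⁅X₁, X₂⁆ X₃ = κ X₁ ⁅X₂, X₃⁆ + κ X₂ ⁅X₃, X₁⁆)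
    (hκ4 : ∀ X₁ X₂ : 𝔤, t (κ X₁ X₂) = t (u ⁅X₁, X₂⁆))
    (I : LieIdeal ℝ 𝔤) (hI : ∀ X : 𝔤, X ∈ I ↔ ∃ Y : 𝔥, t Y = X) :
    (∃! b : (𝔤 ⧸ I) →ₗ[ℝ] (𝔤 ⧸ I) →ₗ[ℝ] ↥t.ker,
        ∀ X₁ X₂ : 𝔤,
          ((b (LieSubmodule.Quotient.mk (N := I) X₁)
              (LieSubmodule.Quotient.mk (N := I) X₂) : ↥t.ker) : 𝔥)
            = (1 / 2 : ℝ) • (κ X₁ X₂ + κ X₂ X₁)) ∧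
    (∀ b : (𝔤 ⧸ I) →ₗ[ℝ] (𝔤 ⧸ I) →ₗ[ℝ] ↥t.ker,
      (∀ X₁ X₂ : 𝔤,
          ((b (LieSubmodule.Quotient.mk (N := I) X₁)
              (LieSubmodule.Quotient.mk (N := I) X₂) : ↥t.ker) : 𝔥)
            = (1 / 2 : ℝ) • (κ X₁ X₂ + κ X₂ X₁)) →
      (∀ Z₁ Z₂ : 𝔤 ⧸ I, b Z₁ Z₂ = b Z₂ Z₁) ∧
      (∀ Z₁ Z₂ Z₃ : 𝔤 ⧸ I, b ⁅Z₁, Z₂⁆ Z₃ = b Z₁ ⁅Z₂, Z₃⁆)) := by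
  have surj : Function.Surjective (LieSubmodule.Quotient.mk (N := I)) :=
    LieSubmodule.Quotient.surjective_mk' I
  refine ⟨?_, fun b hb => ⟨fun Z₁ Z₂ => ?_, fun Z₁ Z₂ Z₃ => ?_⟩⟩
  · have mem_ker (X₁ X₂ : 𝔤) : (1 / 2 : ℝ) • (κ X₁ X₂ + κ X₂ X₁) ∈ t.ker := by
      rw [LieHom.mem_ker, map_smul, map_add, hκ4, hκ4, ← map_add, ← map_add,
        ← lie_skew X₁ X₂, neg_add_cancel, map_zero, map_zero, smul_zero]
    let s : 𝔤 →ₗ[ℝ] 𝔤 →ₗ[ℝ] ↥t.ker :=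
      LinearMap.mk₂ ℝ (fun X₁ X₂ => ⟨(1 / 2 : ℝ) • (κ X₁ X₂ + κ X₂ X₁), mem_ker X₁ X₂⟩)
        (fun _ _ _ => Subtype.ext (by simp; module)) (fun _ _ _ => Subtype.ext (by simp; module))
        (fun _ _ _ => Subtype.ext (by simp; module)) (fun _ _ _ => Subtype.ext (by simp; module))
    obtain ⟨b, hb⟩ := LinearMap.exists_quotient_bilinear I.toSubmodule s
      (fun X hX X' => by
        obtain ⟨Y, rfl⟩ := (hI X).1 hX
        exact Subtype.ext (by simp [s, hκ1, hκ2]))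
      (fun X X' hX' => by
        obtain ⟨Y, rfl⟩ := (hI X').1 hX'
        exact Subtype.ext (by simp [s, hκ1, hκ2]))
    refine ⟨b, fun X₁ X₂ => congrArg Subtype.val (hb X₁ X₂), fun b' hb' => ?_⟩
    refine LinearMap.ext fun Z₁ => LinearMap.ext fun Z₂ => ?_
    obtain ⟨X₁, rfl⟩ := surj Z₁
    obtain ⟨X₂, rfl⟩ := surj Z₂
    exact Subtype.ext ((hb' X₁ X₂).trans (congrArg Subtype.val (hb X₁ X₂)).symm)
  · obtain ⟨X₁, rfl⟩ := surj Z₁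
    obtain ⟨X₂, rfl⟩ := surj Z₂
    exact Subtype.ext (by rw [hb, hb, add_comm])
  · obtain ⟨X₁, rfl⟩ := surj Z₁
    obtain ⟨X₂, rfl⟩ := surj Z₂
    obtain ⟨X₃, rfl⟩ := surj Z₃
    rw [← LieSubmodule.Quotient.mk_bracket, ← LieSubmodule.Quotient.mk_bracket]
    exact Subtype.ext (by rw [hb, hb, hκ3 X₁ X₂ X₃, hκ3 X₂ X₃ X₁, add_assoc])
end

section
/- Let (H, G, t, α) be a crossed module of groups and A := ker t. Consider the action of A on H × G × H given by a • (h, g, h') := (h·a, g, a⁻¹·h') (a group action since A is abelian). Then the map Ψ : H × G × H → G × G × H, Ψ(h, g, h') := (g, t(h)·g, h·h'), is constant on A-orbits and induces a bijection from the orbit space (H × G × H)/A onto T := { (g₁, g₂, k) ∈ G × G × H : g₂·g₁⁻¹ ∈ range(t) }. Moreover Ψ intertwines the right H-actions (h, g, h')·k₀ := (h, g, h'·k₀) and (g₁, g₂, k)·k₀ := (g₁, g₂, k·k₀), and it intertwines the anchor maps (h, g, h') ↦ t(h')⁻¹ and (g₁, g₂, k) ↦ t(k)⁻¹·g₂·g₁⁻¹.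 -/
/-- For a crossed module `(H, G, t, α)` with `A := ker t`, the map
`Ψ(h, g, h') := (g, t h · g, h · h')` is constant on the orbits of the `A`-action
`a • (h, g, h') = (h·a, g, a⁻¹·h')`, induces a bijection from the orbit space onto
`T = {(g₁, g₂, k) : g₂·g₁⁻¹ ∈ range t}`, and intertwines the right `H`-actions and
the anchor maps. -/
theorem extension_of_Gamma1_trivialization
    {H G : Type*} [Group H] [Group G]
    (t : H →* G) (α : G →* MulAut H)
    (h_equiv : ∀ (g : G) (h : H), t (α g h) = g * t h * g⁻¹)
    (h_peiffer : ∀ h h' : H, α (t h) h' = h * h' * h⁻¹)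
    (Ψ : H × G × H → G × G × H)
    (hΨ : ∀ (h : H) (g : G) (h' : H), Ψ (h, g, h') = (g, t h * g, h * h'))
    (T : Set (G × G × H))
    (hT : T = {z | z.2.1 * z.1⁻¹ ∈ t.range}) :
    (∀ (x : H × G × H) (a : H), a ∈ t.ker →
        Ψ (x.1 * a, x.2.1, a⁻¹ * x.2.2) = Ψ x) ∧
    (∀ x y : H × G × H,
        Ψ x = Ψ y ↔ ∃ a ∈ t.ker, y = (x.1 * a, x.2.1, a⁻¹ * x.2.2)) ∧
    Set.range Ψ = T ∧
    (∀ (x : H × G × H) (k₀ : H),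
        Ψ (x.1, x.2.1, x.2.2 * k₀) = ((Ψ x).1, (Ψ x).2.1, (Ψ x).2.2 * k₀)) ∧
    (∀ x : H × G × H, (t (Ψ x).2.2)⁻¹ * (Ψ x).2.1 * ((Ψ x).1)⁻¹ = (t x.2.2)⁻¹) := by
  subst hT
  refine ⟨?_, ?_, ?_, ?_, ?_⟩
  · rintro ⟨h, g, h'⟩ a ha
    rw [MonoidHom.mem_ker] at ha
    simp [hΨ, ha, mul_assoc]
  · rintro ⟨h, g, h'⟩ ⟨k, g', k'⟩
    simp only [hΨ, Prod.mk.injEq, MonoidHom.mem_ker]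
    constructor
    · rintro ⟨rfl, ht, hk⟩
      have ht' : t h = t k := mul_right_cancel ht
      refine ⟨h⁻¹ * k, by simp [ht'], by group, rfl, ?_⟩
      rw [mul_inv_rev, inv_inv, mul_assoc, hk, inv_mul_cancel_left]
    · rintro ⟨a, ha, rfl, rfl, rfl⟩
      simp [ha, mul_assoc]
  · ext ⟨g₁, g₂, k⟩
    simp only [Set.mem_range, Set.mem_ofPred_eq, MonoidHom.mem_range]
    constructor
    · rintro ⟨⟨h, g, h'⟩, hx⟩
      simp only [hΨ, Prod.mk.injEq] at hx
      obtain ⟨rfl, rfl, rfl⟩ := hx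
      exact ⟨h, by group⟩
    · rintro ⟨h, hh⟩
      exact ⟨(h, g₁, h⁻¹ * k), by simp [hΨ, hh]⟩
  · rintro ⟨h, g, h'⟩ k₀
    simp [hΨ, mul_assoc]
  · rintro ⟨h, g, h'⟩
    simp [hΨ, mul_assoc]
end

section
/- Let H be a group, P a set with a right H-action, and φ : P → Aut(H) a map satisfying φ(p·h) = conj(h)⁻¹ ∘ φ(p) for all p ∈ P and h ∈ H, where conj(h) denotes the inner automorphism k ↦ h·k·h⁻¹. Define h·p := p·(φ(p)(h)). Then: (a) this defines a left H-action on P; (b) the left and right actions commute, i.e. (h·p)·h' = h·(p·h') for all h, h' ∈ H, p ∈ P; (c) if the right action is free then so is the left action, and if the right action is transitive then so is the left action. -/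
/-- Let `P` carry a right `H`-action `r` and a map `φ : P → Aut H` with
`φ (p·h) = conj(h)⁻¹ ∘ φ p`. Then `h · p := p · (φ p h)` defines a left `H`-action,
the two actions commute, and freeness resp. transitivity of the right action imply
freeness resp. transitivity of the left action. -/
theorem bibundle_left_action
    {H P : Type*} [Group H]
    (r : P → H → P)
    (hr1 : ∀ p : P, r p 1 = p)
    (hr2 : ∀ (p : P) (h h' : H), r (r p h) h' = r p (h * h'))
    (φ : P → MulAut H)
    (hφ : ∀ (p : P) (h : H), φ (r p h) = (MulAut.conj h)⁻¹ * φ p)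
    (l : H → P → P)
    (hl : ∀ (h : H) (p : P), l h p = r p (φ p h)) :
    ((∀ p : P, l 1 p = p) ∧
      ∀ (h₁ h₂ : H) (p : P), l (h₁ * h₂) p = l h₁ (l h₂ p)) ∧
    (∀ (h h' : H) (p : P), r (l h p) h' = l h (r p h')) ∧
    ((∀ (p : P) (h : H), r p h = p → h = 1) →
      ∀ (h : H) (p : P), l h p = p → h = 1) ∧
    ((∀ p q : P, ∃ h : H, r p h = q) → ∀ p q : P, ∃ h : H, l h p = q) := by
  refine ⟨⟨fun p => by rw [hl, map_one, hr1], fun h₁ h₂ p => ?_⟩, fun h h' p => ?_,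
    fun hfree h p hp => ?_, fun htrans p q => ?_⟩
  · simp only [hl, hφ, hr2, map_mul, MulAut.mul_apply, MulAut.conj_inv_apply]
    congr 1
    group
  · simp only [hl, hφ, hr2, MulAut.mul_apply, MulAut.conj_inv_apply]
    congr 1
    group
  · rw [hl] at hp
    exact (map_eq_one_iff (φ p) (φ p).injective).mp (hfree p _ hp)
  · obtain ⟨k, hk⟩ := htrans p q
    exact ⟨(φ p).symm k, by rw [hl, MulEquiv.apply_symm_apply, hk]⟩
end

section
/- Let (H, G, t, α) be a crossed module of groups and let (P, ·, φ) be a Γ-torsor. Define p ∗ h := p · (α(φ(p))(h⁻¹)) and φ*(p) := φ(p)⁻¹. Then ∗ is a right H-action on P which is free and transitive, and φ* satisfies φ*(p ∗ h) = t(h)⁻¹ · φ*(p) for all p ∈ P, h ∈ H; in other words, (P, ∗, φ*) is again a Γ-torsor. -/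
/-- The dual of a `Γ`-torsor: for a torsor `(P, r, φ)` over a crossed module
`(H, G, t, α)`, the formulas `p ∗ h := p · (α (φ p) h⁻¹)` and `φ*(p) := (φ p)⁻¹`
define again a `Γ`-torsor structure on `P`. -/
theorem gammaTorsor_dual
    {H G P : Type*} [Group H] [Group G] [Nonempty P]
    (t : H →* G) (α : G →* MulAut H)
    (h_equiv : ∀ (g : G) (h : H), t (α g h) = g * t h * g⁻¹)
    (h_peiffer : ∀ h h' : H, α (t h) h' = h * h' * h⁻¹)
    (r : P → H → P)
    (hr1 : ∀ p : P, r p 1 = p)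
    (hr2 : ∀ (p : P) (h h' : H), r (r p h) h' = r p (h * h'))
    (hft : ∀ p q : P, ∃! h : H, r p h = q)
    (φ : P → G)
    (hφ : ∀ (p : P) (h : H), φ (r p h) = (t h)⁻¹ * φ p)
    (r' : P → H → P) (hr' : ∀ (p : P) (h : H), r' p h = r p (α (φ p) h⁻¹))
    (φ' : P → G) (hφ' : ∀ p : P, φ' p = (φ p)⁻¹) :
    (∀ p : P, r' p 1 = p) ∧
    (∀ (p : P) (h h' : H), r' (r' p h) h' = r' p (h * h')) ∧
    (∀ p q : P, ∃! h : H, r' p h = q) ∧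
    (∀ (p : P) (h : H), φ' (r' p h) = (t h)⁻¹ * φ' p) := by
  have anchor (p : P) (h : H) : φ (r' p h) = φ p * t h := by
    rw [hr', hφ, h_equiv, map_inv]
    group
  refine ⟨fun p => by simp [hr', hr1], fun p h h' => ?_, fun p q => ?_, fun p h => ?_⟩
  · rw [hr' (r' p h), anchor, hr' p h, hr2, hr', map_mul, MulAut.mul_apply, h_peiffer, ← map_mul]
    congr 2
    group
  · obtain ⟨k, hk, hk_unique⟩ := hft p q
    refine ⟨((α (φ p)).symm k)⁻¹, ?_, fun h hh => ?_⟩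
    · simp only [hr', inv_inv, MulEquiv.apply_symm_apply, hk]
    · rw [← hk_unique _ ((hr' p h).symm.trans hh), MulEquiv.symm_apply_apply, inv_inv]
  · rw [hφ', hφ', anchor, mul_inv_rev]
end

section
/- Let (H, G, t, α) be a crossed module of groups, A := ker t, and let (P, ·, φ) be a Γ-torsor such that φ(p) ∈ range(t) for every p ∈ P. Then: (a) P_red := { p ∈ P : φ(p) = 1 } is nonempty and stable under the action of A; (b) A acts freely and transitively on P_red; (c) the map P_red × H → P, (p, h) ↦ p·h, is constant on the orbits of the A-action a • (p, h) := (p·a, a⁻¹·h) on P_red × H (a group action since A is abelian) and induces a bijection ((P_red × H)/A) → P. -/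
/-- Reduction of a `Γ`-torsor with anchor values in `range t`:
(a) `P_red = {p : φ p = 1}` is nonempty and stable under `A = ker t`;
(b) `A` acts freely and transitively on `P_red`;
(c) `(p, h) ↦ p·h` is constant on the `A`-orbits `a • (p,h) = (p·a, a⁻¹·h)` of
`P_red × H` and induces a bijection `(P_red × H)/A → P`. -/
theorem gammaTorsor_reduction
    {H G P : Type*} [Group H] [Group G] [Nonempty P]
    (t : H →* G) (α : G →* MulAut H)
    (h_equiv : ∀ (g : G) (h : H), t (α g h) = g * t h * g⁻¹)
    (h_peiffer : ∀ h h' : H, α (t h) h' = h * h' * h⁻¹)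
    (r : P → H → P)
    (hr1 : ∀ p : P, r p 1 = p)
    (hr2 : ∀ (p : P) (h h' : H), r (r p h) h' = r p (h * h'))
    (hft : ∀ p q : P, ∃! h : H, r p h = q)
    (φ : P → G)
    (hφ : ∀ (p : P) (h : H), φ (r p h) = (t h)⁻¹ * φ p)
    (hrange : ∀ p : P, φ p ∈ t.range) :
    (∃ p : P, φ p = 1) ∧
    (∀ (p : P) (a : H), φ p = 1 → a ∈ t.ker → φ (r p a) = 1) ∧
    (∀ p q : P, φ p = 1 → φ q = 1 → ∃! a : H, a ∈ t.ker ∧ r p a = q) ∧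
    (∀ (p : P) (a h : H), φ p = 1 → a ∈ t.ker → r (r p a) (a⁻¹ * h) = r p h) ∧
    (∀ (p p' : P) (h h' : H), φ p = 1 → φ p' = 1 →
      (r p h = r p' h' ↔ ∃ a ∈ t.ker, p' = r p a ∧ h' = a⁻¹ * h)) ∧
    (∀ q : P, ∃ (p : P) (h : H), φ p = 1 ∧ r p h = q) := by
  have stable (p : P) (a : H) (hp : φ p = 1) (ha : a ∈ t.ker) : φ (r p a) = 1 := by
    rw [hφ, hp, MonoidHom.mem_ker.mp ha, inv_one, one_mul]
  have mem_ker (p : P) (a : H) (hp : φ p = 1) (hpa : φ (r p a) = 1) : a ∈ t.ker := by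
    rw [hφ, hp, mul_one, inv_eq_one] at hpa
    exact MonoidHom.mem_ker.mpr hpa
  have orbit (p : P) (a h : H) : r (r p a) (a⁻¹ * h) = r p h := by
    rw [hr2, mul_inv_cancel_left]
  have surj (q : P) : ∃ (p : P) (h : H), φ p = 1 ∧ r p h = q := by
    obtain ⟨k, hk⟩ := hrange q
    refine ⟨r q k, k⁻¹, ?_, ?_⟩
    · rw [hφ, hk, inv_mul_cancel]
    · rw [hr2, mul_inv_cancel, hr1]
  refine ⟨?_, stable, ?_, fun p a h _ _ => orbit p a h, ?_, surj⟩
  · obtain ⟨p, -, hp, -⟩ := surj (Classical.arbitrary P)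
    exact ⟨p, hp⟩
  · intro p q hp hq
    obtain ⟨a, rfl, ha⟩ := hft p q
    exact ⟨a, ⟨mem_ker p a hp hq, rfl⟩, fun b hb => ha b hb.2⟩
  · intro p p' h h' hp hp'
    constructor
    · intro e
      obtain ⟨a, rfl, -⟩ := hft p p'
      refine ⟨a, mem_ker p a hp hp', rfl, ?_⟩
      rw [hr2] at e
      rw [(hft p (r p (a * h'))).unique e rfl, inv_mul_cancel_left]
    · rintro ⟨a, -, rfl, rfl⟩
      exact (orbit p a h).symm
end

section
/- Let (H, G, t, α) be a crossed module of groups and let (P₁, ·, φ₁) and (P₂, ·, φ₂) be Γ-torsors. On P₁ × P₂ consider the equivalence relation generated by (p₁·h, p₂) ∼ (p₁, p₂·α(φ₁(p₁)⁻¹)(h)) for h ∈ H, and let P₁ ⊗ P₂ denote the quotient set. Then: (a) the right H-action (p₁, p₂)·h := (p₁·h, p₂) descends to a right H-action on P₁ ⊗ P₂; (b) the map (p₁, p₂) ↦ φ₁(p₁)·φ₂(p₂) descends to a map φ : P₁ ⊗ P₂ → G; (c) with these data, P₁ ⊗ P₂ is again a Γ-torsor, i.e. the induced H-action is free and transitive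 and φ(x·h) = t(h)⁻¹·φ(x) for all x ∈ P₁ ⊗ P₂ and h ∈ H. -/
/-- The tensor product of two `Γ`-torsors `(P₁, r₁, φ₁)` and `(P₂, r₂, φ₂)` over a
crossed module `(H, G, t, α)`: on the quotient of `P₁ × P₂` by the equivalence relation
generated by `(p₁·h, p₂) ∼ (p₁, p₂·α(φ₁ p₁)⁻¹ h)`,
(a) the right `H`-action `(p₁,p₂)·h := (p₁·h, p₂)` descends,
(b) the anchor `(p₁,p₂) ↦ φ₁ p₁ · φ₂ p₂` descends, and
(c) with these data the quotient is again a `Γ`-torsor. -/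
theorem gammaTorsor_tensor
    {H G P₁ P₂ : Type*} [Group H] [Group G] [Nonempty P₁] [Nonempty P₂]
    (t : H →* G) (α : G →* MulAut H)
    (h_equiv : ∀ (g : G) (h : H), t (α g h) = g * t h * g⁻¹)
    (h_peiffer : ∀ h h' : H, α (t h) h' = h * h' * h⁻¹)
    (r₁ : P₁ → H → P₁)
    (hr₁1 : ∀ p : P₁, r₁ p 1 = p)
    (hr₁2 : ∀ (p : P₁) (h h' : H), r₁ (r₁ p h) h' = r₁ p (h * h'))
    (hft₁ : ∀ p q : P₁, ∃! h : H, r₁ p h = q)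
    (φ₁ : P₁ → G)
    (hφ₁ : ∀ (p : P₁) (h : H), φ₁ (r₁ p h) = (t h)⁻¹ * φ₁ p)
    (r₂ : P₂ → H → P₂)
    (hr₂1 : ∀ p : P₂, r₂ p 1 = p)
    (hr₂2 : ∀ (p : P₂) (h h' : H), r₂ (r₂ p h) h' = r₂ p (h * h'))
    (hft₂ : ∀ p q : P₂, ∃! h : H, r₂ p h = q)
    (φ₂ : P₂ → G)
    (hφ₂ : ∀ (p : P₂) (h : H), φ₂ (r₂ p h) = (t h)⁻¹ * φ₂ p)
    (Rel : P₁ × P₂ → P₁ × P₂ → Prop)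
    (hRel : ∀ x y, Rel x y ↔ ∃ (p₁ : P₁) (p₂ : P₂) (h : H),
        x = (r₁ p₁ h, p₂) ∧ y = (p₁, r₂ p₂ (α (φ₁ p₁)⁻¹ h))) :
    ∃ (s : Quot Rel → H → Quot Rel) (φ : Quot Rel → G),
      (∀ (x : P₁ × P₂) (h : H),
          s (Quot.mk Rel x) h = Quot.mk Rel (r₁ x.1 h, x.2)) ∧
      (∀ x : P₁ × P₂, φ (Quot.mk Rel x) = φ₁ x.1 * φ₂ x.2) ∧
      (∀ q : Quot Rel, s q 1 = q) ∧
      (∀ (q : Quot Rel) (h h' : H), s (s q h) h' = s q (h * h')) ∧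
      (∀ q q' : Quot Rel, ∃! h : H, s q h = q') ∧
      (∀ (q : Quot Rel) (h : H), φ (s q h) = (t h)⁻¹ * φ q) := by
  have hact : ∀ (k : H) (x y : P₁ × P₂), Rel x y →
      Quot.mk Rel (r₁ x.1 k, x.2) = Quot.mk Rel (r₁ y.1 k, y.2) := by
    intro k x y hxy
    obtain ⟨p₁, p₂, h, rfl, rfl⟩ := (hRel x y).1 hxy
    refine Quot.sound ((hRel _ _).2 ⟨r₁ p₁ k, p₂, k⁻¹ * h * k, ?_, ?_⟩)
    · simp only [hr₁2, mul_assoc, mul_inv_cancel_left]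
    · have hconj : α (φ₁ (r₁ p₁ k))⁻¹ (k⁻¹ * h * k) = α (φ₁ p₁)⁻¹ h := by
        rw [hφ₁, mul_inv_rev, inv_inv, map_mul α, MulAut.mul_apply, h_peiffer]
        congr 1
        group
      rw [hconj]
  have hanchor : ∀ x y : P₁ × P₂, Rel x y → φ₁ x.1 * φ₂ x.2 = φ₁ y.1 * φ₂ y.2 := by
    intro x y hxy
    obtain ⟨p₁, p₂, h, rfl, rfl⟩ := (hRel x y).1 hxy
    simp only [hφ₁, hφ₂, h_equiv]
    group
  obtain ⟨b⟩ := ‹Nonempty P₁›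
  choose d hd hd_unique using fun p => hft₁ b p
  have hd_act : ∀ p h, d (r₁ p h) = d p * h := fun p h =>
    (hd_unique _ _ (by simp only [← hr₁2, hd])).symm
  -- The base point `b` identifies the quotient with `P₂`.
  let f : P₁ × P₂ → P₂ := fun x => r₂ x.2 (α (φ₁ b)⁻¹ (d x.1))
  have hf : ∀ x y, Rel x y → f x = f y := by
    intro x y hxy
    obtain ⟨p₁, p₂, h, rfl, rfl⟩ := (hRel x y).1 hxy
    have hφ : φ₁ p₁ = (t (d p₁))⁻¹ * φ₁ b := by rw [← hφ₁, hd]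
    simp only [f, hd_act, hr₂2, hφ, mul_inv_rev, inv_inv]
    rw [map_mul α, MulAut.mul_apply, h_peiffer, ← map_mul, inv_mul_cancel_right]
  let F : Quot Rel → P₂ := Quot.lift f hf
  have hmk : ∀ q, q = Quot.mk Rel (b, F q) := by
    rintro ⟨x⟩
    exact Quot.sound ((hRel _ _).2 ⟨b, x.2, d x.1, by rw [hd], rfl⟩)
  have hF : Function.Injective F := fun q q' h => by rw [hmk q, hmk q', h]
  let s : Quot Rel → H → Quot Rel := fun q h =>
    Quot.lift (fun x => Quot.mk Rel (r₁ x.1 h, x.2)) (hact h) q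
  have hFs : ∀ q h, F (s q h) = r₂ (F q) (α (φ₁ b)⁻¹ h) := by
    rintro ⟨x⟩ h
    simp only [F, s, f, hd_act, hr₂2, map_mul]
  refine ⟨s, Quot.lift (fun x => φ₁ x.1 * φ₂ x.2) hanchor, fun _ _ => rfl, fun _ => rfl,
    ?_, ?_, ?_, ?_⟩
  · intro q
    apply hF
    rw [hFs, map_one, hr₂1]
  · intro q h h'
    apply hF
    rw [hFs, hFs, hFs, hr₂2, map_mul]
  · intro q q'
    obtain ⟨k, hk, hk_unique⟩ := hft₂ (F q) (F q')
    refine ⟨(α (φ₁ b)⁻¹).symm k, hF ?_, ?_⟩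
    · rw [hFs, MulEquiv.apply_symm_apply, hk]
    · rintro h rfl
      rw [← hk_unique _ (hFs q h).symm, MulEquiv.symm_apply_apply]
  · rintro ⟨x⟩ h
    simp only [s, hφ₁, mul_assoc]
end
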